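/- Let R be a polarized rewrite system such that the relations →₋ and →₊ commute. If π is a proof-term of Γ ⊢_R A in polarized natural deduction modulo R, the context Γ' is obtained from Γ by replacing each declared formula B by a formula B' with B →₊ B', and A →₋ A', then π is also a proof-term of Γ' ⊢_R A'. -/

import Mathlib

/-- Propositional formulas: atoms (indexed by naturals), ⊥, ⇒, ∧, ∨. -/
inductive Form : Type where
  | atom : ℕ → Form
  | bot  : Form
  | imp  : Form → Form → Form
  | and  : Form → Form → Form
  | or   : Form → Form → Form

/-- A polarized rewrite system: a set of negative rules and a set of positive
rules, each rewriting an atomic proposition to an arbitrary formula. -/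
structure PRS : Type where
  neg : ℕ → Form → Prop
  pos : ℕ → Form → Prop

mutual
  /-- One step negative rewriting →₋¹. -/
  inductive Neg1 (R : PRS) : Form → Form → Prop where
    | rule {P A} : R.neg P A → Neg1 R (.atom P) A
    | impL {A A' B} : Pos1 R A A' → Neg1 R (.imp A B) (.imp A' B)
    | impR {A B B'} : Neg1 R B B' → Neg1 R (.imp A B) (.imp A B')
    | andL {A A' B} : Neg1 R A A' → Neg1 R (.and A B) (.and A' B)
    | andR {A B B'} : Neg1 R B B' → Neg1 R (.and A B) (.and A B')
    | orL  {A A' B} : Neg1 R A A' → Neg1 R (.or A B) (.or A' B)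
    | orR  {A B B'} : Neg1 R B B' → Neg1 R (.or A B) (.or A B')
  /-- One step positive rewriting →₊¹. -/
  inductive Pos1 (R : PRS) : Form → Form → Prop where
    | rule {P A} : R.pos P A → Pos1 R (.atom P) A
    | impL {A A' B} : Neg1 R A A' → Pos1 R (.imp A B) (.imp A' B)
    | impR {A B B'} : Pos1 R B B' → Pos1 R (.imp A B) (.imp A B')
    | andL {A A' B} : Pos1 R A A' → Pos1 R (.and A B) (.and A' B)
    | andR {A B B'} : Pos1 R B B' → Pos1 R (.and A B) (.and A B')
    | orL  {A A' B} : Pos1 R A A' → Pos1 R (.or A B) (.or A' B)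
    | orR  {A B B'} : Pos1 R B B' → Pos1 R (.or A B) (.or A B')
end

/-- →₋ : reflexive-transitive closure of →₋¹. -/
def NegR (R : PRS) : Form → Form → Prop := Relation.ReflTransGen (Neg1 R)

/-- →₊ : reflexive-transitive closure of →₊¹. -/
def PosR (R : PRS) : Form → Form → Prop := Relation.ReflTransGen (Pos1 R)

/-- The relations →₋ and →₊ commute. -/
def Commutes (R : PRS) : Prop :=
  ∀ A B C, NegR R B A → PosR R B C → ∃ D, PosR R A D ∧ NegR R C D

/-- Proof-terms (de Bruijn representation of the proof variables). -/
inductive PTerm : Type where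
  | var  : ℕ → PTerm
  | lam  : PTerm → PTerm
  | app  : PTerm → PTerm → PTerm
  | pair : PTerm → PTerm → PTerm
  | fst  : PTerm → PTerm
  | snd  : PTerm → PTerm
  | inl  : PTerm → PTerm
  | inr  : PTerm → PTerm
  | case : PTerm → PTerm → PTerm → PTerm
  | exf  : PTerm → PTerm

/-- Shift by one all de Bruijn indices ≥ c. -/
def liftAbove (c : ℕ) : PTerm → PTerm
  | .var n => if n < c then .var n else .var (n+1)
  | .lam π => .lam (liftAbove (c+1) π)
  | .app a b => .app (liftAbove c a) (liftAbove c b)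
  | .pair a b => .pair (liftAbove c a) (liftAbove c b)
  | .fst a => .fst (liftAbove c a)
  | .snd a => .snd (liftAbove c a)
  | .inl a => .inl (liftAbove c a)
  | .inr a => .inr (liftAbove c a)
  | .case a b c' => .case (liftAbove c a) (liftAbove (c+1) b) (liftAbove (c+1) c')
  | .exf a => .exf (liftAbove c a)

/-- Substitution [u/k]π of the term u for the variable k. -/
def subst (k : ℕ) (u : PTerm) : PTerm → PTerm
  | .var n => if n < k then .var n else if n = k then u else .var (n-1)
  | .lam π => .lam (subst (k+1) (liftAbove 0 u) π)
  | .app a b => .app (subst k u a) (subst k u b)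
  | .pair a b => .pair (subst k u a) (subst k u b)
  | .fst a => .fst (subst k u a)
  | .snd a => .snd (subst k u a)
  | .inl a => .inl (subst k u a)
  | .inr a => .inr (subst k u a)
  | .case a b c => .case (subst k u a) (subst (k+1) (liftAbove 0 u) b) (subst (k+1) (liftAbove 0 u) c)
  | .exf a => .exf (subst k u a)

/-- Typing judgement of polarized natural deduction modulo R:
`Typed R Γ π A` means "π is a proof-term of Γ ⊢_R A".
A context is a finite list of formulas (the declaration of variable n is the
n-th entry of the list). -/
inductive Typed (R : PRS) : List Form → PTerm → Form → Prop where
  | ax {Γ n A B C} : Γ[n]? = some A → NegR R A C → PosR R B C →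
      Typed R Γ (.var n) B
  | impI {Γ π A B C} : Typed R (A :: Γ) π B → PosR R C (.imp A B) →
      Typed R Γ (.lam π) C
  | impE {Γ π₁ π₂ A B C} : Typed R Γ π₁ C → NegR R C (.imp A B) →
      Typed R Γ π₂ A → Typed R Γ (.app π₁ π₂) B
  | andI {Γ π₁ π₂ A B C} : Typed R Γ π₁ A → Typed R Γ π₂ B →
      PosR R C (.and A B) → Typed R Γ (.pair π₁ π₂) C
  | andE₁ {Γ π A B C} : Typed R Γ π C → NegR R C (.and A B) →
      Typed R Γ (.fst π) A
  | andE₂ {Γ π A B C} : Typed R Γ π C → NegR R C (.and A B) →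
      Typed R Γ (.snd π) B
  | orI₁ {Γ π A B C} : Typed R Γ π A → PosR R C (.or A B) →
      Typed R Γ (.inl π) C
  | orI₂ {Γ π A B C} : Typed R Γ π B → PosR R C (.or A B) →
      Typed R Γ (.inr π) C
  | orE {Γ π₁ π₂ π₃ A B C D} : Typed R Γ π₁ D → NegR R D (.or A B) →
      Typed R (A :: Γ) π₂ C → Typed R (B :: Γ) π₃ C →
      Typed R Γ (.case π₁ π₂ π₃) C
  | botE {Γ π A B} : Typed R Γ π B → NegR R B .bot →
      Typed R Γ (.exf π) A

/-- One step proof reduction ▷¹ (contextual closure of the cut elimination rules). -/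
inductive Red1 : PTerm → PTerm → Prop where
  | beta {π₁ π₂} : Red1 (.app (.lam π₁) π₂) (subst 0 π₂ π₁)
  | fstPair {π₁ π₂} : Red1 (.fst (.pair π₁ π₂)) π₁
  | sndPair {π₁ π₂} : Red1 (.snd (.pair π₁ π₂)) π₂
  | caseInl {π₁ π₂ π₃} : Red1 (.case (.inl π₁) π₂ π₃) (subst 0 π₁ π₂)
  | caseInr {π₁ π₂ π₃} : Red1 (.case (.inr π₁) π₂ π₃) (subst 0 π₁ π₃)
  | lam {π π'} : Red1 π π' → Red1 (.lam π) (.lam π')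
  | appL {π π' ρ} : Red1 π π' → Red1 (.app π ρ) (.app π' ρ)
  | appR {π ρ ρ'} : Red1 ρ ρ' → Red1 (.app π ρ) (.app π ρ')
  | pairL {π π' ρ} : Red1 π π' → Red1 (.pair π ρ) (.pair π' ρ)
  | pairR {π ρ ρ'} : Red1 ρ ρ' → Red1 (.pair π ρ) (.pair π ρ')
  | fst {π π'} : Red1 π π' → Red1 (.fst π) (.fst π')
  | snd {π π'} : Red1 π π' → Red1 (.snd π) (.snd π')
  | inl {π π'} : Red1 π π' → Red1 (.inl π) (.inl π')
  | inr {π π'} : Red1 π π' → Red1 (.inr π) (.inr π')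
  | case₁ {π π' ρ τ} : Red1 π π' → Red1 (.case π ρ τ) (.case π' ρ τ)
  | case₂ {π ρ ρ' τ} : Red1 ρ ρ' → Red1 (.case π ρ τ) (.case π ρ' τ)
  | case₃ {π ρ τ τ'} : Red1 τ τ' → Red1 (.case π ρ τ) (.case π ρ τ')
  | exf {π π'} : Red1 π π' → Red1 (.exf π) (.exf π')

/-- ▷ : reflexive-transitive closure of ▷¹. -/
def Red : PTerm → PTerm → Prop := Relation.ReflTransGen Red1

/-- A proof-term is strongly normalizable if every ▷¹-reduction sequence from
it is finite, i.e. it is accessible for the inverse of ▷¹. -/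
def SN (π : PTerm) : Prop := Acc (fun x y => Red1 y x) π

/-- Neutral proof-terms: variables and eliminations, not introductions. -/
def Neutral : PTerm → Prop
  | .var _ => True
  | .app _ _ => True
  | .fst _ => True
  | .snd _ => True
  | .case _ _ _ => True
  | .exf _ => True
  | _ => False

/-- Reducibility candidates. -/
structure IsCandidate (S : Set PTerm) : Prop where
  sn : ∀ π ∈ S, SN π
  closed : ∀ π ∈ S, ∀ π', Red π π' → π' ∈ S
  neutral : ∀ π, Neutral π → (∀ π', Red1 π π' → π' ∈ S) → π ∈ S

/-- A pre-model is an assignment of a reducibility candidate to each atom. -/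
def IsPreModel (M : ℕ → Set PTerm) : Prop := ∀ P, IsCandidate (M P)

/-- The interpretation |A| of a formula in a pre-model. -/
def interp (M : ℕ → Set PTerm) : Form → Set PTerm
  | .atom P => M P
  | .bot => {π | SN π}
  | .imp A B => {π | SN π ∧ ∀ π₁, Red π (.lam π₁) →
      ∀ π' ∈ interp M A, subst 0 π' π₁ ∈ interp M B}
  | .and A B => {π | SN π ∧ ∀ π₁ π₂, Red π (.pair π₁ π₂) →
      π₁ ∈ interp M A ∧ π₂ ∈ interp M B}
  | .or A B => {π | SN π ∧ (∀ π₁, Red π (.inl π₁) → π₁ ∈ interp M A) ∧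
      (∀ π₂, Red π (.inr π₂) → π₂ ∈ interp M B)}

/-- A pre-model of a polarized rewrite system R. -/
def IsPreModelOf (R : PRS) (M : ℕ → Set PTerm) : Prop :=
  IsPreModel M ∧
  (∀ P A, R.neg P A → interp M (.atom P) ⊆ interp M A) ∧
  (∀ P A, R.pos P A → interp M A ⊆ interp M (.atom P))

theorem NegR.imp_right {R : PRS} {A B B' : Form} (h : NegR R B B') :
    NegR R (.imp A B) (.imp A B') :=
  Relation.ReflTransGen.lift (Form.imp A) (fun _ _ => Neg1.impR) _ _ h

theorem NegR.and_left {R : PRS} {A A' B : Form} (h : NegR R A A') :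
    NegR R (.and A B) (.and A' B) :=
  Relation.ReflTransGen.lift (fun X => Form.and X B) (fun _ _ => Neg1.andL) _ _ h

theorem NegR.and_right {R : PRS} {A B B' : Form} (h : NegR R B B') :
    NegR R (.and A B) (.and A B') :=
  Relation.ReflTransGen.lift (Form.and A) (fun _ _ => Neg1.andR) _ _ h

theorem NegR.imp_inv {R : PRS} {A B D : Form} (h : NegR R (.imp A B) D) :
    ∃ A' B', D = .imp A' B' ∧ PosR R A A' ∧ NegR R B B' := by
  induction h with
  | refl => exact ⟨A, B, rfl, .refl, .refl⟩
  | tail _ hstep ih =>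
    obtain ⟨A', B', rfl, hA, hB⟩ := ih
    cases hstep with
    | impL h => exact ⟨_, _, rfl, hA.tail h, hB⟩
    | impR h => exact ⟨_, _, rfl, hA, hB.tail h⟩

theorem NegR.and_inv {R : PRS} {A B D : Form} (h : NegR R (.and A B) D) :
    ∃ A' B', D = .and A' B' ∧ NegR R A A' ∧ NegR R B B' := by
  induction h with
  | refl => exact ⟨A, B, rfl, .refl, .refl⟩
  | tail _ hstep ih =>
    obtain ⟨A', B', rfl, hA, hB⟩ := ih
    cases hstep with
    | andL h => exact ⟨_, _, rfl, hA.tail h, hB⟩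
    | andR h => exact ⟨_, _, rfl, hA, hB.tail h⟩

theorem NegR.or_inv {R : PRS} {A B D : Form} (h : NegR R (.or A B) D) :
    ∃ A' B', D = .or A' B' ∧ NegR R A A' ∧ NegR R B B' := by
  induction h with
  | refl => exact ⟨A, B, rfl, .refl, .refl⟩
  | tail _ hstep ih =>
    obtain ⟨A', B', rfl, hA, hB⟩ := ih
    cases hstep with
    | orL h => exact ⟨_, _, rfl, hA.tail h, hB⟩
    | orR h => exact ⟨_, _, rfl, hA, hB.tail h⟩

theorem List.Forall₂.exists_getElem?_eq_some {α β : Type*} {r : α → β → Prop}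
    {l : List α} {l' : List β} (h : List.Forall₂ r l l') {n : ℕ} {a : α}
    (ha : l[n]? = some a) : ∃ b, l'[n]? = some b ∧ r a b := by
  induction h generalizing n with
  | nil => simp at ha
  | cons hr _ ih =>
    cases n with
    | zero => simp_all
    | succ n => simpa using ih (by simpa using ha)

/-- If →₋ and →₊ commute, π is a proof-term of Γ ⊢_R A, Γ' is obtained from Γ
by replacing each declared formula B by some B' with B →₊ B', and A →₋ A',
then π is also a proof-term of Γ' ⊢_R A'. -/
theorem typed_ctx_pos_concl_neg_rewrite (R : PRS) (hcomm : Commutes R)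
    (Γ Γ' : List Form) (π : PTerm) (A A' : Form)
    (h : Typed R Γ π A)
    (hΓ : List.Forall₂ (PosR R) Γ Γ')
    (hAA' : NegR R A A') :
    Typed R Γ' π A' := by
  induction h generalizing Γ' A' with
  | ax hn hAC hBC =>
    obtain ⟨A₁, hn', hA₁⟩ := hΓ.exists_getElem?_eq_some hn
    obtain ⟨D, hCD, hA₁D⟩ := hcomm _ _ _ hAC hA₁
    obtain ⟨E, hA'E, hCE⟩ := hcomm _ _ _ hAA' hBC
    obtain ⟨F, hEF, hDF⟩ := hcomm _ _ _ hCE hCD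
    exact .ax hn' (hA₁D.trans hDF) (hA'E.trans hEF)
  | impI _ hC ih =>
    obtain ⟨D, hD, hABD⟩ := hcomm _ _ _ hAA' hC
    obtain ⟨_, _, rfl, hA, hB⟩ := hABD.imp_inv
    exact .impI (ih _ _ (.cons hA hΓ) hB) hD
  | impE _ hC _ ih₁ ih₂ =>
    exact .impE (ih₁ _ _ hΓ (hC.trans (NegR.imp_right hAA'))) .refl (ih₂ _ _ hΓ .refl)
  | andI _ _ hC ih₁ ih₂ =>
    obtain ⟨D, hD, hABD⟩ := hcomm _ _ _ hAA' hC
    obtain ⟨_, _, rfl, hA, hB⟩ := hABD.and_inv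
    exact .andI (ih₁ _ _ hΓ hA) (ih₂ _ _ hΓ hB) hD
  | andE₁ _ hC ih => exact .andE₁ (ih _ _ hΓ (hC.trans (NegR.and_left hAA'))) .refl
  | andE₂ _ hC ih => exact .andE₂ (ih _ _ hΓ (hC.trans (NegR.and_right hAA'))) .refl
  | orI₁ _ hC ih =>
    obtain ⟨D, hD, hABD⟩ := hcomm _ _ _ hAA' hC
    obtain ⟨_, _, rfl, hA, _⟩ := hABD.or_inv
    exact .orI₁ (ih _ _ hΓ hA) hD
  | orI₂ _ hC ih =>
    obtain ⟨D, hD, hABD⟩ := hcomm _ _ _ hAA' hC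
    obtain ⟨_, _, rfl, _, hB⟩ := hABD.or_inv
    exact .orI₂ (ih _ _ hΓ hB) hD
  | orE _ hD _ _ ih₁ ih₂ ih₃ =>
    exact .orE (ih₁ _ _ hΓ hD) .refl (ih₂ _ _ (.cons .refl hΓ) hAA')
      (ih₃ _ _ (.cons .refl hΓ) hAA')
  | botE _ hB ih => exact .botE (ih _ _ hΓ hB) .refl
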